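/- arXiv:1902.05403 — 2 statements merged into one kernel-verified Lean document; each statement's English description precedes it below -/
import Mathlib

section
/- Let 𝔤₁ and 𝔤₂ be finite-dimensional complex semisimple Lie algebras, and let 𝔥₁ ⊆ 𝔤₁ and 𝔥₂ ⊆ 𝔤₂ be Lie subalgebras. Then the orthogonal complement of 𝔥₁ × 𝔥₂ in 𝔤₁ × 𝔤₂ with respect to the Killing form of 𝔤₁ × 𝔤₂ contains a regular element of 𝔤₁ × 𝔤₂ if and only if, for each i ∈ {1,2}, the orthogonal complement 𝔥ᵢ^⊥ of 𝔥ᵢ with respect to the Killing form of 𝔤ᵢ contains a regular element of 𝔤ᵢ. -/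
/-- The componentwise Lie ring structure on the product of two Lie rings. -/
instance prodLieRing (L₁ L₂ : Type*) [LieRing L₁] [LieRing L₂] : LieRing (L₁ × L₂) where
  bracket x y := (⁅x.1, y.1⁆, ⁅x.2, y.2⁆)
  add_lie x y z := by simp [Prod.ext_iff, add_lie]
  lie_add x y z := by simp [Prod.ext_iff, lie_add]
  lie_self x := by simp [Prod.ext_iff]
  leibniz_lie x y z := Prod.ext_iff.mpr ⟨leibniz_lie x.1 y.1 z.1, leibniz_lie x.2 y.2 z.2⟩

/-- The componentwise Lie algebra structure on the product of two Lie algebras. -/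
instance prodLieAlgebra (R L₁ L₂ : Type*) [CommRing R] [LieRing L₁] [LieRing L₂]
    [LieAlgebra R L₁] [LieAlgebra R L₂] : LieAlgebra R (L₁ × L₂) where
  lie_smul t x y := Prod.ext_iff.mpr ⟨lie_smul t x.1 y.1, lie_smul t x.2 y.2⟩

/-- An element `x` of a finite-dimensional Lie algebra `L` over `K` is *regular* if the
dimension of `ker (ad x)` is minimal among all elements of `L`. -/
def IsRegularElement (K : Type*) {L : Type*} [Field K] [LieRing L] [LieAlgebra K L]
    (x : L) : Prop :=
  ∀ y : L, Module.finrank K (LinearMap.ker (LieAlgebra.ad K L x)) ≤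
    Module.finrank K (LinearMap.ker (LieAlgebra.ad K L y))

theorem ad_prod_eq {L₁ L₂ : Type*} [LieRing L₁] [LieAlgebra ℂ L₁] [LieRing L₂] [LieAlgebra ℂ L₂]
    (x : L₁ × L₂) : LieAlgebra.ad ℂ (L₁ × L₂) x =
      (LieAlgebra.ad ℂ L₁ x.1).prodMap (LieAlgebra.ad ℂ L₂ x.2) := by
  apply LinearMap.ext
  intro y
  rfl

theorem killing_prod_eq {L₁ L₂ : Type*} [LieRing L₁] [LieAlgebra ℂ L₁] [FiniteDimensional ℂ L₁]
    [LieRing L₂] [LieAlgebra ℂ L₂] [FiniteDimensional ℂ L₂]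
    (x y : L₁ × L₂) : killingForm ℂ (L₁ × L₂) x y =
      killingForm ℂ L₁ x.1 y.1 + killingForm ℂ L₂ x.2 y.2 := by
  rw [killingForm_apply_apply, killingForm_apply_apply, killingForm_apply_apply,
    ad_prod_eq, ad_prod_eq, ← LinearMap.trace_prodMap']
  rfl

theorem finrank_ker_ad_prod {L₁ L₂ : Type*} [LieRing L₁] [LieAlgebra ℂ L₁]
    [FiniteDimensional ℂ L₁] [LieRing L₂] [LieAlgebra ℂ L₂] [FiniteDimensional ℂ L₂]
    (x : L₁ × L₂) : Module.finrank ℂ (LinearMap.ker (LieAlgebra.ad ℂ (L₁ × L₂) x)) =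
      Module.finrank ℂ (LinearMap.ker (LieAlgebra.ad ℂ L₁ x.1)) +
      Module.finrank ℂ (LinearMap.ker (LieAlgebra.ad ℂ L₂ x.2)) := by
  rw [ad_prod_eq, LinearMap.ker_prodMap, ← Module.finrank_prod]
  exact LinearEquiv.finrank_eq
    { toFun := fun z => (⟨z.1.1, z.2.1⟩, ⟨z.1.2, z.2.2⟩)
      invFun := fun w => ⟨(w.1.1, w.2.1), ⟨w.1.2, w.2.2⟩⟩
      map_add' := fun _ _ => rfl
      map_smul' := fun _ _ => rfl
      left_inv := fun _ => rfl
      right_inv := fun _ => rfl }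

/-- For semisimple complex Lie algebras `L₁`, `L₂` with Lie subalgebras `H₁ ⊆ L₁`, `H₂ ⊆ L₂`,
the Killing-orthogonal complement of `H₁ × H₂` in `L₁ × L₂` contains a regular element of
`L₁ × L₂` if and only if for each `i`, the Killing-orthogonal complement of `Hᵢ` in `Lᵢ`
contains a regular element of `Lᵢ`. -/
theorem killingOrthogonal_prod_regular_iff {L₁ L₂ : Type*}
    [LieRing L₁] [LieAlgebra ℂ L₁] [FiniteDimensional ℂ L₁] [LieAlgebra.IsSemisimple ℂ L₁]
    [LieRing L₂] [LieAlgebra ℂ L₂] [FiniteDimensional ℂ L₂] [LieAlgebra.IsSemisimple ℂ L₂]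
    (H₁ : LieSubalgebra ℂ L₁) (H₂ : LieSubalgebra ℂ L₂) :
    (∃ x : L₁ × L₂,
        (∀ h₁ ∈ H₁, ∀ h₂ ∈ H₂, killingForm ℂ (L₁ × L₂) x (h₁, h₂) = 0) ∧
        IsRegularElement ℂ x) ↔
      ((∃ x₁ : L₁, (∀ h ∈ H₁, killingForm ℂ L₁ x₁ h = 0) ∧ IsRegularElement ℂ x₁) ∧
       (∃ x₂ : L₂, (∀ h ∈ H₂, killingForm ℂ L₂ x₂ h = 0) ∧ IsRegularElement ℂ x₂)) := by
  constructor
  · rintro ⟨⟨a, b⟩, ho, hr⟩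
    refine ⟨⟨a, fun h hh => ?_, fun y => ?_⟩, ⟨b, fun h hh => ?_, fun y => ?_⟩⟩
    · have := ho h hh 0 H₂.zero_mem
      rw [killing_prod_eq] at this
      simpa using this
    · have := hr (y, b)
      rw [finrank_ker_ad_prod, finrank_ker_ad_prod] at this
      exact Nat.le_of_add_le_add_right this
    · have := ho 0 H₁.zero_mem h hh
      rw [killing_prod_eq] at this
      simpa using this
    · have := hr (a, y)
      rw [finrank_ker_ad_prod, finrank_ker_ad_prod] at this
      exact Nat.le_of_add_le_add_left this
  · rintro ⟨⟨a, ha, ra⟩, ⟨b, hb, rb⟩⟩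
    refine ⟨(a, b), fun h₁ hh₁ h₂ hh₂ => ?_, fun y => ?_⟩
    · rw [killing_prod_eq, ha h₁ hh₁, hb h₂ hh₂, add_zero]
    · rw [finrank_ker_ad_prod, finrank_ker_ad_prod]
      exact Nat.add_le_add (ra y.1) (rb y.2)
end

section
/- Let 𝔤 be a finite-dimensional complex semisimple Lie algebra and 𝔥 ⊆ 𝔤 a Lie subalgebra. Then (𝔤, 𝔥) is a symmetric pair (i.e. 𝔥 is the fixed-point subalgebra 𝔤^θ of some involutive Lie algebra automorphism θ of 𝔤) if and only if there exist finitely many ideals 𝔤₁, …, 𝔤ₙ of 𝔤 and ideals 𝔥₁, …, 𝔥ₙ of 𝔥 with 𝔥ᵢ ⊆ 𝔤ᵢ for each i, such that 𝔤 is the internal direct sum of the 𝔤ᵢ, 𝔥 is the internal direct sum of the 𝔥ᵢ, and each pair (𝔤ᵢ, 𝔥ᵢ) is a strictly indecomposable symmetric pair. -/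
section Defs

variable {R L : Type*} [CommRing R] [LieRing L] [LieAlgebra R L]

/-- `(L, H)` is a *symmetric pair* if `H` is the fixed-point subalgebra of some involutive
Lie algebra automorphism of `L`. -/
def IsSymmetricPair (H : LieSubalgebra R L) : Prop :=
  ∃ θ : L ≃ₗ⁅R⁆ L, (∀ x, θ (θ x) = x) ∧ ∀ x, x ∈ H ↔ θ x = x

/-- `(L, H)` is *decomposable* if there are nonzero proper ideals `g₁, g₂` of `L` and ideals
`h₁, h₂` of `H` with `L = g₁ ⊕ g₂`, `H = h₁ ⊕ h₂`, `h₁ ⊆ g₁` and `h₂ ⊆ g₂`. -/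
def IsDecomposablePair (H : LieSubalgebra R L) : Prop :=
  ∃ (g₁ g₂ : LieIdeal R L) (h₁ h₂ : LieSubalgebra R L),
    g₁ ≠ ⊥ ∧ g₁ ≠ ⊤ ∧ g₂ ≠ ⊥ ∧ g₂ ≠ ⊤ ∧
    g₁ ⊔ g₂ = ⊤ ∧ g₁ ⊓ g₂ = ⊥ ∧
    h₁ ≤ H ∧ h₂ ≤ H ∧
    (∀ x ∈ H, ∀ y ∈ h₁, ⁅x, y⁆ ∈ h₁) ∧ (∀ x ∈ H, ∀ y ∈ h₂, ⁅x, y⁆ ∈ h₂) ∧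
    h₁.toSubmodule ⊔ h₂.toSubmodule = H.toSubmodule ∧ h₁.toSubmodule ⊓ h₂.toSubmodule = ⊥ ∧
    (∀ y ∈ h₁, y ∈ g₁) ∧ (∀ y ∈ h₂, y ∈ g₂)

/-- The derived subalgebra `[H, H]` of a Lie subalgebra `H ⊆ L`, regarded as a Lie subalgebra
of `L`: the Lie subalgebra generated by all brackets of elements of `H`. -/
def derivedSubalgebra (H : LieSubalgebra R L) : LieSubalgebra R L :=
  LieSubalgebra.lieSpan R L {z : L | ∃ x ∈ H, ∃ y ∈ H, ⁅x, y⁆ = z}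

/-- `(L, H)` is *strictly indecomposable* if `(L, [H, H])` is indecomposable. -/
def IsStrictlyIndecomposablePair (H : LieSubalgebra R L) : Prop :=
  ¬ IsDecomposablePair (derivedSubalgebra H)

end Defs

section Helpers

variable {L : Type*} [LieRing L] [LieAlgebra ℂ L]

/-- Gluing involutions on the summands of a direct sum of ideals. -/
theorem isSymmetricPair_of_directSum {n : ℕ} (H : LieSubalgebra ℂ L)
    (g : Fin n → LieIdeal ℂ L) (h : Fin n → LieSubalgebra ℂ L)
    (hg : ∀ i, ∀ y ∈ h i, y ∈ g i)
    (hind : iSupIndep g) (htop : (⨆ i, g i) = ⊤)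
    (hH : (⨆ i, (h i).toSubmodule) = H.toSubmodule)
    (hs : ∀ i, IsSymmetricPair (LieSubalgebra.comap (g i).incl (h i))) :
    IsSymmetricPair H := by
  classical
  choose θ hθ hfix using hs
  have hind' : iSupIndep (fun i => (g i).toSubmodule) :=
    LieSubmodule.iSupIndep_toSubmodule.mpr hind
  have htop' : (⨆ i, (g i).toSubmodule) = ⊤ := by
    rw [← LieSubmodule.iSup_toSubmodule, htop, LieSubmodule.top_toSubmodule]
  have hinternal := DirectSum.isInternal_submodule_of_iSupIndep_of_iSup_eq_top hind' htop'
  let e := LinearEquiv.ofBijective (DirectSum.coeLinearMap (fun i => (g i).toSubmodule)) hinternal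
  let S : (DirectSum (Fin n) fun i => (g i).toSubmodule) →ₗ[ℂ] L :=
    DirectSum.toModule ℂ (Fin n) L
      (fun i => (g i).toSubmodule.subtype ∘ₗ ((θ i).toLinearEquiv : g i →ₗ[ℂ] g i))
  let T : L →ₗ[ℂ] L := S ∘ₗ (e.symm : L →ₗ[ℂ] _)
  have hT : ∀ i (x : g i), T x = (θ i x : L) := by
    intro i x
    have : e.symm (x : L) = DirectSum.lof ℂ (Fin n) (fun i => (g i).toSubmodule) i x := by
      rw [LinearEquiv.symm_apply_eq]
      exact (DirectSum.coeLinearMap_lof (fun i => (g i).toSubmodule) i x).symm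
    change S (e.symm (x : L)) = _
    rw [this]
    simp only [S]
    rw [DirectSum.toModule_lof]
    rfl
  have ind : ∀ (p : L → Prop), (∀ i (x : g i), p x) → p 0 → (∀ x y, p x → p y → p (x + y)) →
      ∀ x, p x := by
    intro p h1 h2 h3 x
    have hx : x ∈ ⨆ i, (g i).toSubmodule := by rw [htop']; trivial
    exact Submodule.iSup_induction _ (motive := p) hx (fun i x hx => h1 i ⟨x, hx⟩) h2 h3
  have hTT : ∀ x, T (T x) = x := by
    refine ind _ ?_ (by simp) ?_
    · intro i x
      rw [hT, hT, hθ]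
    · intro x y hx hy
      rw [map_add, map_add, hx, hy]
  have hzero : ∀ i j, i ≠ j → ∀ (x : g i) (y : g j), ⁅(x : L), (y : L)⁆ = 0 := by
    intro i j hij x y
    have hd := (hind.pairwiseDisjoint hij).eq_bot
    have hm : ⁅(x : L), (y : L)⁆ ∈ g i ⊓ g j :=
      ⟨lie_mem_left ℂ L (g i) _ _ x.2, lie_mem_right ℂ L (g j) _ _ y.2⟩
    have hd' : g i ⊓ g j = ⊥ := hd
    rw [hd'] at hm
    simpa using hm
  have hlie : ∀ x y, T ⁅x, y⁆ = ⁅T x, T y⁆ := by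
    refine ind _ ?_ (by simp) ?_
    · intro i x
      refine ind _ ?_ (by simp) ?_
      · intro j y
        by_cases hij : i = j
        · subst hij
          rw [hT, hT]
          have := hT i ⁅x, y⁆
          rw [LieEquiv.map_lie] at this
          exact this
        · rw [hzero i j hij, hT, hT, hzero i j hij, map_zero]
      · intro y z hy hz
        rw [lie_add, map_add, map_add, lie_add, hy, hz]
    · intro x x' hx hx' y
      rw [add_lie, map_add, map_add, add_lie, hx, hx']
  have hsum : ∀ x, x + T x ∈ H := by
    refine ind _ ?_ (by simp) ?_
    · intro i x
      have h1 : θ i (x + θ i x) = x + θ i x := by rw [map_add, hθ, add_comm]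
      have h2 := (hfix i _).2 h1
      have h3 : (x : L) + T x ∈ h i := by
        rw [hT]; exact h2
      change _ ∈ H.toSubmodule
      rw [← hH]
      exact Submodule.mem_iSup_of_mem i h3
    · intro x y hx hy
      have : x + y + T (x + y) = (x + T x) + (y + T y) := by rw [map_add]; abel
      rw [this]
      exact add_mem hx hy
  let Th : L →ₗ⁅ℂ⁆ L := { T with map_lie' := fun {x y} => hlie x y }
  refine ⟨{ Th with invFun := T, left_inv := hTT, right_inv := hTT }, hTT, ?_⟩
  intro x
  change x ∈ H ↔ T x = x
  constructor
  · intro hx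
    have hx' : x ∈ ⨆ i, (h i).toSubmodule := by rw [hH]; exact hx
    refine Submodule.iSup_induction _ (motive := fun x => T x = x) hx' ?_ (by simp) ?_
    · intro i y hy
      have := (hfix i ⟨y, hg i y hy⟩).1 hy
      have h2 := hT i ⟨y, hg i y hy⟩
      rw [this] at h2
      exact h2
    · intro y z hy hz
      rw [map_add, hy, hz]
  · intro hx
    have h1 := hsum x
    rw [hx] at h1
    have h2 : x = (1 / 2 : ℂ) • (x + x) := by
      rw [← two_smul ℂ x, smul_smul]; norm_num
    rw [h2]
    exact H.smul_mem _ h1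

variable [LieAlgebra.IsSemisimple ℂ L]

theorem ss_exists_compl (J : LieIdeal ℂ L) : ∃ J' : LieIdeal ℂ L,
    J ⊔ J' = ⊤ ∧ J ⊓ J' = ⊥ ∧ ∀ K : LieIdeal ℂ L, K ⊓ J = ⊥ → K ≤ J' := by
  refine ⟨Jᶜ, sup_compl_eq_top, inf_compl_eq_bot, ?_⟩
  intro K hK
  exact le_compl_iff_disjoint_right.2 (disjoint_iff.2 hK)

theorem ss_abelian (J : LieIdeal ℂ L) (h : ∀ x ∈ J, ∀ y ∈ J, ⁅x, y⁆ = 0) : J = ⊥ := by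
  refine (LieAlgebra.hasTrivialRadical_iff_no_abelian_ideals ℂ L).1 inferInstance J ⟨?_⟩
  intro x y
  ext
  exact h x x.2 y y.2

theorem ss_lift (g : LieIdeal ℂ L) (g₁ : LieIdeal ℂ g) :
    ∃ J : LieIdeal ℂ L, ∀ x, x ∈ J ↔ ∃ h : x ∈ g, (⟨x, h⟩ : g) ∈ g₁ := by
  obtain ⟨g', h1, h2, -⟩ := ss_exists_compl g
  refine ⟨{ g₁.toSubmodule.map g.toSubmodule.subtype with lie_mem := ?_ }, ?_⟩
  · rintro x m hm
    simp only [AddSubsemigroup.mem_carrier, AddSubmonoid.mem_toSubsemigroup,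
      Submodule.mem_toAddSubmonoid, Submodule.mem_map] at hm ⊢
    obtain ⟨y, hy, rfl⟩ := hm
    have hx : x ∈ g ⊔ g' := by rw [h1]; trivial
    obtain ⟨a, ha, b, hb, rfl⟩ := (LieSubmodule.mem_sup _ _ _).1 hx
    refine ⟨⁅(⟨a, ha⟩ : g), y⁆, lie_mem_right ℂ g g₁ _ _ hy, ?_⟩
    have hm : ⁅b, (y : L)⁆ ∈ g ⊓ g' :=
      ⟨lie_mem_right ℂ L g _ _ y.2, lie_mem_left ℂ L g' _ _ hb⟩
    rw [h2] at hm
    have hm' : ⁅b, (y : L)⁆ = 0 := by simpa using hm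
    change ⁅a, (y : L)⁆ = ⁅a + b, (y : L)⁆
    rw [add_lie, hm', add_zero]
  · intro x
    constructor
    · rintro ⟨y, hy, rfl⟩
      exact ⟨y.2, hy⟩
    · rintro ⟨h, hx⟩
      exact ⟨⟨x, h⟩, hx, rfl⟩

theorem ss_min_strict (θ : L ≃ₗ⁅ℂ⁆ L) (hθ : ∀ x, θ (θ x) = x) (g : LieIdeal ℂ L)
    (hgθ : ∀ x ∈ g, θ x ∈ g)
    (hmin : ∀ J : LieIdeal ℂ L, J ≤ g → (∀ x ∈ J, θ x ∈ J) → J = ⊥ ∨ J = g)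
    (K : LieSubalgebra ℂ g) (hK : ∀ x, x ∈ K ↔ θ x = x) :
    IsStrictlyIndecomposablePair K := by
  rintro ⟨g₁, g₂, h₁, h₂, n1, t1, n2, t2, -, -, l1, l2, -, -, hsup, -, i1, i2⟩
  have hder : derivedSubalgebra K ≤ K := by
    refine LieSubalgebra.lieSpan_le.2 ?_
    rintro z ⟨x, hx, y, hy, rfl⟩
    exact K.lie_mem hx hy
  have key : ∀ p : LieIdeal ℂ g, p ≠ ⊤ → ∀ x : L, ∀ hx : x ∈ g, (⟨x, hx⟩ : g) ∈ p →
      (⟨θ x, hgθ x hx⟩ : g) ∈ p → x = 0 := by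
    intro p hp x hx hx1 hx2
    obtain ⟨J, hJ⟩ := ss_lift g p
    have hc := hmin (J ⊓ J.comap θ.toLieHom) (fun y hy => ((hJ y).1 hy.1).1) ?_
    · rcases hc with hc | hc
      · have hm : x ∈ J ⊓ J.comap θ.toLieHom :=
          ⟨(hJ x).2 ⟨hx, hx1⟩, (hJ (θ x)).2 ⟨hgθ x hx, hx2⟩⟩
        rw [hc] at hm
        simpa using hm
      · exfalso
        apply hp
        rw [eq_top_iff]
        rintro ⟨y, hy⟩ -
        rw [← hc] at hy
        exact ((hJ y).1 hy.1).2
    · rintro y ⟨hy1, hy2⟩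
      refine ⟨hy2, ?_⟩
      change θ (θ y) ∈ J
      rw [hθ]; exact hy1
  have fix0 : ∀ p : LieIdeal ℂ g, p ≠ ⊤ → ∀ x : g, x ∈ p → x ∈ K → x = 0 := by
    intro p hp x hx hxK
    have h1 := (hK x).1 hxK
    ext
    refine key p hp x x.2 hx ?_
    have : (⟨θ x, hgθ x x.2⟩ : g) = x := Subtype.ext h1
    rw [this]; exact hx
  have habK : ∀ x ∈ K, ∀ y ∈ K, ⁅x, y⁆ = 0 := by
    intro x hx y hy
    have hm : ⁅x, y⁆ ∈ (derivedSubalgebra K).toSubmodule :=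
      LieSubalgebra.subset_lieSpan ⟨x, hx, y, hy, rfl⟩
    rw [← hsup] at hm
    obtain ⟨a, ha, b, hb, hab⟩ := Submodule.mem_sup.1 hm
    rw [← hab, fix0 g₁ t1 a (i1 a ha) (hder (l1 ha)), fix0 g₂ t2 b (i2 b hb) (hder (l2 hb)),
      add_zero]
  -- `g₁` is abelian
  obtain ⟨J, hJ⟩ := ss_lift g g₁
  have hJ0 : ∀ x, x ∈ J → θ x ∈ J → x = 0 := by
    intro x h1 h2
    obtain ⟨hx, hx'⟩ := (hJ x).1 h1
    exact key g₁ t1 x hx hx' ((hJ _).1 h2).2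
  have hJb : J = ⊥ := by
    refine ss_abelian J ?_
    intro x hx y hy
    have cross : ∀ u ∈ J, ∀ v ∈ J, ⁅u, θ v⁆ = 0 := by
      intro u hu v hv
      refine hJ0 _ (lie_mem_left ℂ L J _ _ hu) ?_
      rw [LieEquiv.map_lie, hθ]
      exact lie_mem_right ℂ L J _ _ hv
    have hxg := ((hJ x).1 hx).1
    have hyg := ((hJ y).1 hy).1
    have hfx : (⟨x + θ x, add_mem hxg (hgθ x hxg)⟩ : g) ∈ K := by
      rw [hK]; change θ (x + θ x) = x + θ x
      rw [map_add, hθ, add_comm]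
    have hfy : (⟨y + θ y, add_mem hyg (hgθ y hyg)⟩ : g) ∈ K := by
      rw [hK]; change θ (y + θ y) = y + θ y
      rw [map_add, hθ, add_comm]
    have h0 := congrArg (Subtype.val) (habK _ hfx _ hfy)
    have h0' : ⁅x + θ x, y + θ y⁆ = 0 := h0
    have c1 := cross x hx y hy
    have c2 : ⁅θ x, y⁆ = 0 := by
      rw [← lie_skew, cross y hy x hx, neg_zero]
    rw [add_lie, lie_add, lie_add, c1, c2, add_zero, zero_add, ← LieEquiv.map_lie] at h0'
    have hxy : ⁅x, y⁆ ∈ J := lie_mem_right ℂ L J _ _ hy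
    refine hJ0 _ hxy ?_
    rw [eq_neg_of_add_eq_zero_right h0']
    exact neg_mem hxy
  apply n1
  rw [eq_bot_iff]
  intro x hx
  have hx' : (x : L) ∈ J := (hJ x).2 ⟨x.2, hx⟩
  rw [hJb] at hx'
  have : (x : L) = 0 := by simpa using hx'
  have h0 : x = 0 := Subtype.ext this
  rw [h0]; exact zero_mem _

theorem ss_min_decomp [FiniteDimensional ℂ L] (θ : L ≃ₗ⁅ℂ⁆ L) (hθ : ∀ x, θ (θ x) = x) :
    ∃ (n : ℕ) (g : Fin n → LieIdeal ℂ L), (∀ i, ∀ x ∈ g i, θ x ∈ g i) ∧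
      (∀ i, ∀ J : LieIdeal ℂ L, J ≤ g i → (∀ x ∈ J, θ x ∈ J) → J = ⊥ ∨ J = g i) ∧
      iSupIndep g ∧ (⨆ i, g i) = ⊤ := by
  let S : Set (LieIdeal ℂ L) := {g | g ≠ ⊥ ∧ (∀ x ∈ g, θ x ∈ g) ∧
    ∀ J : LieIdeal ℂ L, J ≤ g → (∀ x ∈ J, θ x ∈ J) → J = ⊥ ∨ J = g}
  have hSind : sSupIndep S := by
    intro g hg
    rw [disjoint_iff]
    refine ss_abelian _ ?_
    rintro x ⟨hx1, -⟩ y ⟨-, hy2⟩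
    rw [sSup_eq_iSup'] at hy2
    refine LieSubmodule.iSup_induction _ (motive := fun y => ⁅x, y⁆ = 0) hy2 ?_ (by simp) ?_
    · rintro ⟨g', hg'⟩ z hz
      have hinf : g ⊓ g' = ⊥ := by
        by_contra hne
        have hst : ∀ x ∈ g ⊓ g', θ x ∈ g ⊓ g' := fun x hx =>
          ⟨hg.2.1 x hx.1, hg'.1.2.1 x hx.2⟩
        have e1 := (hg.2.2 _ inf_le_left hst).resolve_left hne
        have e2 := (hg'.1.2.2 _ inf_le_right hst).resolve_left hne
        exact hg'.2 (e2.symm.trans e1)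
      have hm : ⁅x, z⁆ ∈ g ⊓ g' := ⟨lie_mem_left ℂ L g _ _ hx1, lie_mem_right ℂ L g' _ _ hz⟩
      rw [hinf] at hm
      simpa using hm
    · intro y z hy hz
      rw [lie_add, hy, hz, add_zero]
  have hstab : ∀ x ∈ sSup S, θ x ∈ sSup S := by
    have : sSup S ≤ (sSup S).comap θ.toLieHom := by
      refine sSup_le fun g hg x hx => ?_
      exact le_sSup hg (hg.2.1 x hx)
    exact this
  have hSall : sSup S = ⊤ := by
    obtain ⟨J', h1, h2, h3⟩ := ss_exists_compl (sSup S)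
    have hJ' : ∀ x ∈ J', θ x ∈ J' := by
      have hle : J'.comap θ.toLieHom ≤ J' := by
        apply h3
        rw [eq_bot_iff]
        rintro x ⟨hx1, hx2⟩
        have hm : θ x ∈ sSup S ⊓ J' := ⟨hstab x hx2, hx1⟩
        rw [h2] at hm
        have h0 : θ x = 0 := by simpa using hm
        have : x = 0 := by rw [← hθ x, h0, map_zero]
        rw [this]; exact zero_mem _
      intro x hx
      apply hle
      change θ (θ x) ∈ J'
      rw [hθ]; exact hx
    by_cases hb : J' = ⊥
    · rw [hb, sup_bot_eq] at h1; exact h1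
    exfalso
    have hwf : WellFounded ((· < ·) : LieIdeal ℂ L → LieIdeal ℂ L → Prop) :=
      (LieSubmodule.wellFoundedLT_of_isArtinian ℂ L L).wf
    let P : Set (LieIdeal ℂ L) := {g | g ≤ J' ∧ g ≠ ⊥ ∧ ∀ x ∈ g, θ x ∈ g}
    have hP : P.Nonempty := ⟨J', le_rfl, hb, hJ'⟩
    obtain ⟨m, hmP, hmm⟩ := hwf.has_min P hP
    have hmS : m ∈ S := by
      refine ⟨hmP.2.1, hmP.2.2, fun J hJ hst => ?_⟩
      by_contra hcon
      push Not at hcon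
      exact hmm J ⟨hJ.trans hmP.1, hcon.1, hst⟩ (lt_of_le_of_ne hJ hcon.2)
    apply hmP.2.1
    rw [eq_bot_iff, ← h2]
    exact le_inf (le_sSup hmS) hmP.1
  have hfin : S.Finite := WellFoundedGT.finite_of_sSupIndep hSind
  have : Finite S := hfin
  obtain ⟨n, ⟨e⟩⟩ := Finite.exists_equiv_fin S
  refine ⟨n, fun i => (e.symm i : LieIdeal ℂ L), fun i => (e.symm i).2.2.1,
    fun i => (e.symm i).2.2.2, ?_, ?_⟩
  · exact ((sSupIndep_iff S).1 hSind).comp e.symm.injective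
  · rw [← hSall, sSup_eq_iSup']
    exact e.symm.iSup_comp (g := fun s : S => (s : LieIdeal ℂ L))

end Helpers

/-- A pair `(L, H)` with `L` a finite-dimensional complex semisimple Lie algebra and `H ⊆ L`
a Lie subalgebra is symmetric if and only if there are finitely many ideals `g i` of `L` and
ideals `h i` of `H` with `h i ⊆ g i`, such that `L` is the internal direct sum of the `g i`,
`H` is the internal direct sum of the `h i`, and each pair `(g i, h i)` is a strictly
indecomposable symmetric pair. -/
theorem isSymmetricPair_iff_directSum_strictlyIndecomposable {L : Type*} [LieRing L]
    [LieAlgebra ℂ L] [FiniteDimensional ℂ L] [LieAlgebra.IsSemisimple ℂ L]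
    (H : LieSubalgebra ℂ L) :
    IsSymmetricPair H ↔
      ∃ (n : ℕ) (g : Fin n → LieIdeal ℂ L) (h : Fin n → LieSubalgebra ℂ L),
        (∀ i, h i ≤ H) ∧
        (∀ i, ∀ x ∈ H, ∀ y ∈ h i, ⁅x, y⁆ ∈ h i) ∧
        (∀ i, ∀ y ∈ h i, y ∈ g i) ∧
        iSupIndep g ∧ (⨆ i, g i) = ⊤ ∧
        iSupIndep (fun i => (h i).toSubmodule) ∧
        (⨆ i, (h i).toSubmodule) = H.toSubmodule ∧
        (∀ i, IsSymmetricPair (LieSubalgebra.comap (g i).incl (h i)) ∧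
          IsStrictlyIndecomposablePair (LieSubalgebra.comap (g i).incl (h i))) := by
  constructor
  · rintro ⟨θ, hθ, hfix⟩
    obtain ⟨n, g, hst, hmin, hind, htop⟩ := ss_min_decomp θ hθ
    let h : Fin n → LieSubalgebra ℂ L := fun i => H ⊓ (g i).toLieSubalgebra
    have hmem : ∀ i x, x ∈ h i ↔ x ∈ H ∧ x ∈ g i := fun i x => Iff.rfl
    have htop' : (⨆ i, (g i).toSubmodule) = ⊤ := by
      rw [← LieSubmodule.iSup_toSubmodule, htop, LieSubmodule.top_toSubmodule]
    refine ⟨n, g, h, fun i x hx => hx.1, ?_, fun i y hy => hy.2, hind, htop, ?_, ?_, ?_⟩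
    · intro i x hx y hy
      exact ⟨H.lie_mem hx hy.1, lie_mem_right ℂ L (g i) _ _ hy.2⟩
    · exact (LieSubmodule.iSupIndep_toSubmodule.mpr hind).mono fun i x hx => hx.2
    · apply le_antisymm
      · exact iSup_le fun i x hx => hx.1
      · intro x hx
        have hsum : x + θ x ∈ ⨆ i, (h i).toSubmodule := by
          have hx' : x ∈ ⨆ i, (g i).toSubmodule := by rw [htop']; trivial
          refine Submodule.iSup_induction _
            (motive := fun x => x + θ x ∈ ⨆ i, (h i).toSubmodule) hx' ?_ (by simp) ?_
          · intro i y hy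
            refine Submodule.mem_iSup_of_mem i ?_
            refine ⟨(hfix _).2 ?_, add_mem hy (hst i y hy)⟩
            rw [map_add, hθ, add_comm]
          · intro y z hy hz
            have : y + z + θ (y + z) = (y + θ y) + (z + θ z) := by rw [map_add]; abel
            rw [this]
            exact add_mem hy hz
        rw [(hfix x).1 hx] at hsum
        have h2 : x = (1 / 2 : ℂ) • (x + x) := by
          rw [← two_smul ℂ x, smul_smul]; norm_num
        rw [h2]
        exact Submodule.smul_mem _ _ hsum
    · intro i
      have hK : ∀ x : g i, x ∈ LieSubalgebra.comap (g i).incl (h i) ↔ θ x = x := by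
        intro x
        rw [← hfix]
        exact ⟨fun hx => hx.1, fun hx => ⟨hx, x.2⟩⟩
      refine ⟨?_, ss_min_strict θ hθ (g i) (hst i) (hmin i) _ hK⟩
      let f : g i → g i := fun x => ⟨θ x, hst i x x.2⟩
      have hf : ∀ x, f (f x) = x := fun x => Subtype.ext (hθ x)
      refine ⟨{ toFun := f, invFun := f, left_inv := hf, right_inv := hf,
                map_add' := fun x y => Subtype.ext (map_add θ (x : L) (y : L)),
                map_smul' := fun c x => Subtype.ext (map_smul θ c (x : L)),
                map_lie' := fun {x y} => Subtype.ext (LieEquiv.map_lie θ (x : L) (y : L)) },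
        hf, ?_⟩
      intro x
      rw [hK]
      exact ⟨fun hx => Subtype.ext hx, fun hx => congrArg Subtype.val hx⟩
  · rintro ⟨n, g, h, -, -, hg, hind, htop, -, hH, hs⟩
    exact isSymmetricPair_of_directSum H g h hg hind htop hH fun i => (hs i).1
end
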